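/- Suppose B is a field and there exists a universal φ-derivation (Ω_φ, d_φ) with Ω_φ finite dimensional as a B-vector space. Let Der_K(φ,B) denote the B-module of all φ-derivations A → B, and let d^B_φ : A → Hom_B(Der_K(φ,B), B) be given by d^B_φ(f)(D) = D(f). Then (Hom_B(Der_K(φ,B), B), d^B_φ) is a universal φ-derivation. -/

import Mathlib

universe u

variable {K A B : Type u} [CommRing K] [CommRing A] [Field B] [Algebra K A] [Algebra K B]

/-- A `φ`-derivation with values in a `B`-module `M`. -/
def IsPhiDerivation (φ : A →ₐ[K] B)
    {M : Type u} [AddCommGroup M] [Module K M] [Module B M] [IsScalarTower K B M]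
    (D : A →ₗ[K] M) : Prop :=
  ∀ f g : A, D (f * g) = φ f • D g + φ g • D f

/-- `(Ω, d)` is a universal `φ`-derivation. -/
def IsUniversalPhiDerivation (φ : A →ₐ[K] B)
    {Ω : Type u} [AddCommGroup Ω] [Module K Ω] [Module B Ω] [IsScalarTower K B Ω]
    (d : A →ₗ[K] Ω) : Prop :=
  IsPhiDerivation φ d ∧
    ∀ (M : Type u) [AddCommGroup M] [Module K M] [Module B M] [IsScalarTower K B M],
      ∀ D : A →ₗ[K] M, IsPhiDerivation φ D → ∃! F : Ω →ₗ[B] M, ∀ a : A, F (d a) = D a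

/-- The `B`-module `Der_K(φ, B)` of all `φ`-derivations `A → B`. -/
def phiDer (φ : A →ₐ[K] B) : Submodule B (A →ₗ[K] B) where
  carrier := {D | IsPhiDerivation φ D}
  add_mem' := by
    intro D D' hD hD' f g
    simp only [LinearMap.add_apply, hD f g, hD' f g, smul_add]
    abel
  zero_mem' := by intro f g; simp
  smul_mem' := by
    intro c D hD f g
    simp only [LinearMap.smul_apply, hD f g, smul_add, smul_comm c]

/-- The map `d^B_φ : A → Hom_B(Der_K(φ,B), B)`, `d^B_φ(f)(D) = D(f)`. -/
def dBPhi (φ : A →ₐ[K] B) : A →ₗ[K] (phiDer φ →ₗ[B] B) where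
  toFun f :=
    { toFun := fun D => (D : A →ₗ[K] B) f
      map_add' := by intro D D'; rfl
      map_smul' := by intro c D; rfl }
  map_add' := by intro f g; ext D; simp
  map_smul' := by intro c f; ext D; simp

/-- Composition of linear functionals with a `φ`-derivation. -/
def IsPhiDerivation.dualToPhiDer {φ : A →ₐ[K] B}
    {Ω : Type u} [AddCommGroup Ω] [Module K Ω] [Module B Ω] [IsScalarTower K B Ω]
    {d : A →ₗ[K] Ω} (hd : IsPhiDerivation φ d) : Module.Dual B Ω →ₗ[B] phiDer φ where
  toFun F := ⟨F.restrictScalars K ∘ₗ d, fun f g => by simp [hd f g]⟩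
  map_add' _ _ := rfl
  map_smul' _ _ := rfl

/-- A universal `φ`-derivation identifies the dual of its target with `Der_K(φ, B)`. -/
noncomputable def IsUniversalPhiDerivation.dualEquivPhiDer {φ : A →ₐ[K] B}
    {Ω : Type u} [AddCommGroup Ω] [Module K Ω] [Module B Ω] [IsScalarTower K B Ω]
    {d : A →ₗ[K] Ω} (hd : IsUniversalPhiDerivation φ d) :
    Module.Dual B Ω ≃ₗ[B] phiDer φ :=
  LinearEquiv.ofBijective hd.1.dualToPhiDer
    ⟨fun _ G h => (hd.2 B _ (hd.1.dualToPhiDer G).2).unique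
        (fun a => LinearMap.congr_fun (congrArg Subtype.val h) a) (fun _ => rfl),
      fun D => (hd.2 B D.1 D.2).exists.imp fun _ hF => Subtype.ext (LinearMap.ext hF)⟩

/-- Universality of a `φ`-derivation is preserved by isomorphisms of its target. -/
theorem IsUniversalPhiDerivation.of_linearEquiv {φ : A →ₐ[K] B}
    {Ω : Type u} [AddCommGroup Ω] [Module K Ω] [Module B Ω] [IsScalarTower K B Ω]
    {Ω' : Type u} [AddCommGroup Ω'] [Module K Ω'] [Module B Ω'] [IsScalarTower K B Ω']
    {d : A →ₗ[K] Ω} {d' : A →ₗ[K] Ω'} (hd : IsUniversalPhiDerivation φ d)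
    (e : Ω ≃ₗ[B] Ω') (he : ∀ a, e (d a) = d' a) : IsUniversalPhiDerivation φ d' := by
  refine ⟨fun f g => by simp only [← he, hd.1 f g, map_add, map_smul], ?_⟩
  intro M _ _ _ _ D hD
  obtain ⟨F, hF, huniq⟩ := hd.2 M D hD
  refine ⟨F ∘ₗ e.symm.toLinearMap, fun a => by simp [← he, hF], fun G hG => ?_⟩
  have h := huniq (G ∘ₗ e.toLinearMap) fun a => by simp [he, hG]
  ext x
  simp [← h]

/-- If `B` is a field and the module of `φ`-differentials is a finite dimensional `B`-vector
space, then `(Hom_B(Der_K(φ,B), B), d^B_φ)` is a universal `φ`-derivation. -/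
theorem dBPhi_universal_of_finiteDimensional (φ : A →ₐ[K] B)
    {Ω : Type u} [AddCommGroup Ω] [Module K Ω] [Module B Ω] [IsScalarTower K B Ω]
    (d : A →ₗ[K] Ω) (hd : IsUniversalPhiDerivation φ d)
    (hfin : FiniteDimensional B Ω) :
    IsUniversalPhiDerivation φ (dBPhi φ) := by
  refine hd.of_linearEquiv
    ((Module.evalEquiv B Ω).trans hd.dualEquivPhiDer.symm.dualMap) fun a => ?_
  ext D
  obtain ⟨F, rfl⟩ := hd.dualEquivPhiDer.surjective D
  simp only [LinearEquiv.trans_apply, LinearEquiv.dualMap_apply, LinearEquiv.symm_apply_apply,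
    Module.evalEquiv_apply]
  rfl
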